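/- For compact convex sets K, T in the plane: V(T,B)·V(K,B) ≥ (2/π)·V(T,K)·V(B,B), where B is the closed unit disk and V denotes the planar mixed volume; equivalently (L(T)/2)(L(K)/2) ≥ 2·V(T,K), where L denotes perimeter. -/

import Mathlib

open MeasureTheory Pointwise

/-- The area of a subset of the plane. -/
noncomputable def area (K : Set (EuclideanSpace ℝ (Fin 2))) : ℝ := (volume K).toReal

/-- The planar mixed volume. -/
noncomputable def mixedVol (K T : Set (EuclideanSpace ℝ (Fin 2))) : ℝ :=
  (area (K + T) - area K - area T) / 2

open Real Filter Topology

/-- The Euclidean plane. -/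
abbrev Plane := EuclideanSpace ℝ (Fin 2)

/-- The scalar product of `x` with the unit vector of angle `θ`. -/
noncomputable def dirCoord (θ : ℝ) (x : Plane) : ℝ := x 0 * cos θ + x 1 * sin θ

/-- The unit vector of angle `θ`. -/
noncomputable def unitDir (θ : ℝ) : Plane := !₂[cos θ, sin θ]

/-- The support function of `K` in terms of the angle of the direction. -/
noncomputable def supp (K : Set Plane) (θ : ℝ) : ℝ := sSup (dirCoord θ '' K)

lemma dirCoord_add (θ : ℝ) (x y : Plane) :
    dirCoord θ (x + y) = dirCoord θ x + dirCoord θ y := by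
  simp only [dirCoord, PiLp.add_apply]; ring

lemma dirCoord_sub (θ : ℝ) (x y : Plane) :
    dirCoord θ (x - y) = dirCoord θ x - dirCoord θ y := by
  simp only [dirCoord, PiLp.sub_apply]; ring

lemma dirCoord_smul (θ r : ℝ) (x : Plane) : dirCoord θ (r • x) = r * dirCoord θ x := by
  simp only [dirCoord, PiLp.smul_apply, smul_eq_mul]; ring

lemma dirCoord_zero (θ : ℝ) : dirCoord θ 0 = 0 := by simp [dirCoord]

lemma continuous_dirCoord (θ : ℝ) : Continuous (dirCoord θ) := by
  unfold dirCoord; fun_prop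

lemma dirCoord_unitDir (θ φ : ℝ) : dirCoord θ (unitDir φ) = cos (θ - φ) := by
  simp only [dirCoord, unitDir, cos_sub]
  simp; ring

lemma dirCoord_angle_add (θ φ : ℝ) (x : Plane) :
    dirCoord (θ + φ) x = cos φ * dirCoord θ x + sin φ * dirCoord (θ + π / 2) x := by
  simp only [dirCoord, cos_add, sin_add, cos_pi_div_two, sin_pi_div_two]; ring

lemma norm_unitDir (θ : ℝ) : ‖unitDir θ‖ = 1 := by
  rw [EuclideanSpace.norm_eq, Real.sqrt_eq_one]
  simp [unitDir]

lemma inner_unitDir (θ : ℝ) (x : Plane) : inner ℝ x (unitDir θ) = dirCoord θ x := by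
  simp [unitDir, dirCoord, PiLp.inner_apply, Fin.sum_univ_two]; ring

lemma abs_dirCoord_le (θ : ℝ) (x : Plane) : |dirCoord θ x| ≤ ‖x‖ := by
  rw [← inner_unitDir]
  simpa [norm_unitDir] using abs_real_inner_le_norm x (unitDir θ)

lemma exists_unitDir_eq (x : Plane) : ∃ θ, x = ‖x‖ • unitDir θ := by
  refine ⟨Complex.arg ⟨x 0, x 1⟩, ?_⟩
  have hn : ‖x‖ = ‖(⟨x 0, x 1⟩ : ℂ)‖ := by
    rw [EuclideanSpace.norm_eq, Complex.norm_eq_sqrt_sq_add_sq]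
    simp [Fin.sum_univ_two]
  ext i
  fin_cases i
  · simp [unitDir, hn, Complex.norm_mul_cos_arg]
  · simp [unitDir, hn, Complex.norm_mul_sin_arg]

section SupportFunction

variable {K T : Set Plane}

lemma bddAbove_dirCoord (hK : IsCompact K) (θ : ℝ) : BddAbove (dirCoord θ '' K) :=
  (hK.image (continuous_dirCoord θ)).bddAbove

lemma dirCoord_le_supp (hK : IsCompact K) (θ : ℝ) {x : Plane} (hx : x ∈ K) :
    dirCoord θ x ≤ supp K θ :=
  le_csSup (bddAbove_dirCoord hK θ) (Set.mem_image_of_mem _ hx)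

lemma exists_dirCoord_eq_supp (hK : IsCompact K) (hne : K.Nonempty) (θ : ℝ) :
    ∃ x ∈ K, dirCoord θ x = supp K θ := by
  obtain ⟨x, hx, h⟩ := hK.exists_sSup_image_eq hne (continuous_dirCoord θ).continuousOn
  exact ⟨x, hx, h.symm⟩

lemma supp_add (hK : IsCompact K) (hKne : K.Nonempty) (hT : IsCompact T) (hTne : T.Nonempty)
    (θ : ℝ) : supp (K + T) θ = supp K θ + supp T θ := by
  have : dirCoord θ '' (K + T) = dirCoord θ '' K + dirCoord θ '' T :=
    Set.image_image2_distrib (dirCoord_add θ)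
  rw [supp, this, csSup_add (hKne.image _) (bddAbove_dirCoord hK θ) (hTne.image _)
    (bddAbove_dirCoord hT θ)]
  rfl

lemma supp_closedBall (θ : ℝ) : supp (Metric.closedBall 0 1) θ = 1 := by
  refine IsGreatest.csSup_eq ⟨⟨unitDir θ, by simp [norm_unitDir], by simp [dirCoord_unitDir]⟩, ?_⟩
  rintro _ ⟨x, hx, rfl⟩
  exact (le_abs_self _).trans ((abs_dirCoord_le θ x).trans (by simpa using hx))

lemma supp_periodic (K : Set Plane) : Function.Periodic (supp K) (2 * π) := by
  intro θ
  have : dirCoord (θ + 2 * π) = dirCoord θ := by ext x; simp [dirCoord]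
  rw [supp, this, supp]

lemma supp_nonneg (hK : IsCompact K) (h0 : (0 : Plane) ∈ K) (θ : ℝ) : 0 ≤ supp K θ := by
  simpa [dirCoord_zero] using dirCoord_le_supp hK θ h0

/-- Sublinearity of a function of the direction, written in terms of angles. -/
def AngleSublinear (h : ℝ → ℝ) : Prop :=
  ∀ θ a b, 0 ≤ a → 0 ≤ b → a + b ≤ π →
    h θ * sin (a + b) ≤ h (θ - a) * sin b + h (θ + b) * sin a

lemma angleSublinear_supp (hK : IsCompact K) (hne : K.Nonempty) : AngleSublinear (supp K) := by
  intro θ a b ha hb hab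
  obtain ⟨x, hx, h⟩ := exists_dirCoord_eq_supp hK hne θ
  have hsa : 0 ≤ sin a := sin_nonneg_of_nonneg_of_le_pi ha (by linarith)
  have hsb : 0 ≤ sin b := sin_nonneg_of_nonneg_of_le_pi hb (by linarith)
  have h1 := mul_le_mul_of_nonneg_right (dirCoord_le_supp hK (θ - a) hx) hsb
  have h2 := mul_le_mul_of_nonneg_right (dirCoord_le_supp hK (θ + b) hx) hsa
  have h3 : dirCoord θ x * sin (a + b) =
      dirCoord (θ - a) x * sin b + dirCoord (θ + b) x * sin a := by
    simp only [dirCoord, cos_add, sin_add, cos_sub, sin_sub]; ring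
  rw [← h, h3]
  linarith

end SupportFunction

section Polygon

/-- The polygon cut out by the half-planes `dirCoord (k * ε) x ≤ h (k * ε)`. -/
def polygon (h : ℝ → ℝ) (ε : ℝ) : Set Plane :=
  {x | ∀ k : ℤ, dirCoord (k * ε) x ≤ h (k * ε)}

/-- The length, up to the factor `sin ε`, of the edge with normal angle `θ`. -/
noncomputable def edge (h : ℝ → ℝ) (ε θ : ℝ) : ℝ := h (θ + ε) + h (θ - ε) - 2 * cos ε * h θ

lemma AngleSublinear.edge_nonneg {h : ℝ → ℝ} (hs : AngleSublinear h) {ε : ℝ} (h0 : 0 < ε)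
    (hε : ε ≤ π / 2) (θ : ℝ) : 0 ≤ edge h ε θ := by
  have hsin : 0 < sin ε := sin_pos_of_pos_of_lt_pi h0 (by linarith [pi_pos])
  have := hs θ ε ε h0.le h0.le (by linarith)
  rw [← two_mul, sin_two_mul] at this
  have : 0 ≤ edge h ε θ * sin ε := by unfold edge; linarith
  exact nonneg_of_mul_nonneg_left this hsin

/-- The endpoint, on the side of the angle `θ + δ`, of the edge with normal angle `θ`. -/
noncomputable def vertex (h : ℝ → ℝ) (θ δ : ℝ) : Plane :=
  h θ • unitDir θ + ((h (θ + δ) - cos δ * h θ) / sin δ) • unitDir (θ + π / 2)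

lemma dirCoord_vertex (h : ℝ → ℝ) (θ δ φ : ℝ) (hδ : sin δ ≠ 0) :
    dirCoord (θ + φ) (vertex h θ δ) * sin δ = h θ * sin (δ - φ) + h (θ + δ) * sin φ := by
  have e1 : θ + φ - θ = φ := by ring
  have e2 : θ + φ - (θ + π / 2) = φ - π / 2 := by ring
  simp only [vertex, dirCoord_add, dirCoord_smul, dirCoord_unitDir, e1, e2, cos_sub_pi_div_two,
    sin_sub]
  field_simp
  ring

lemma dirCoord_vertex_pos_le {h : ℝ → ℝ} (hs : AngleSublinear h) {ε φ : ℝ} (θ : ℝ)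
    (h0 : 0 < ε) (hε : ε < π) (hφ : φ ∈ Set.Icc ε π ∪ Set.Icc (ε - π) 0) :
    dirCoord (θ + φ) (vertex h θ ε) ≤ h (θ + φ) := by
  have hsin : 0 < sin ε := sin_pos_of_pos_of_lt_pi h0 hε
  refine le_of_mul_le_mul_right ?_ hsin
  rw [dirCoord_vertex h θ ε φ hsin.ne']
  rcases hφ with ⟨h1, h2⟩ | ⟨h1, h2⟩
  · have := hs (θ + ε) ε (φ - ε) h0.le (by linarith) (by linarith)
    rw [show ε + (φ - ε) = φ by ring, show θ + ε - ε = θ by ring,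
      show θ + ε + (φ - ε) = θ + φ by ring] at this
    rw [← neg_sub φ ε, sin_neg]
    linarith
  · have := hs θ (-φ) ε (by linarith) h0.le (by linarith)
    rw [show -φ + ε = ε - φ by ring, show θ - -φ = θ + φ by ring, sin_neg] at this
    linarith

lemma AngleSublinear.neg {h : ℝ → ℝ} (hs : AngleSublinear h) :
    AngleSublinear (fun θ => h (-θ)) := by
  intro θ a b ha hb hab
  have := hs (-θ) b a hb ha (by linarith)
  rw [add_comm b a] at this
  simp only [neg_sub, neg_add]
  rw [show a - θ = -θ + a by ring, show -θ + -b = -θ - b by ring]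
  linarith

lemma dirCoord_vertex_neg_le {h : ℝ → ℝ} (hs : AngleSublinear h) {ε φ : ℝ} (θ : ℝ)
    (h0 : 0 < ε) (hε : ε < π) (hφ : φ ∈ Set.Icc ε π ∪ Set.Icc (ε - π) 0) :
    dirCoord (θ - φ) (vertex h θ (-ε)) ≤ h (θ - φ) := by
  have hsin : 0 < sin ε := sin_pos_of_pos_of_lt_pi h0 hε
  have := dirCoord_vertex_pos_le hs.neg (-θ) h0 hε hφ
  refine le_of_mul_le_mul_right ?_ hsin
  have h1 := dirCoord_vertex h θ (-ε) (-φ) (by simpa using hsin.ne')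
  have h2 := dirCoord_vertex (fun θ => h (-θ)) (-θ) ε φ hsin.ne'
  have h3 := mul_le_mul_of_nonneg_right this hsin.le
  rw [h2] at h3
  simp only [neg_neg, neg_add] at h3
  rw [show -ε - -φ = -(ε - φ) by ring] at h1
  simp only [sin_neg] at h1
  simp only [sub_eq_add_neg] at *
  linarith

/-- Every multiple of `π / M` agrees modulo `2 * π` with one that is at most `π` in absolute value
and avoids the open interval between `0` and `π / M`. -/
lemma exists_angle_repr {M : ℕ} (hM : 0 < M) (k : ℤ) :
    ∃ φ ∈ Set.Icc (π / M) π ∪ Set.Icc (π / M - π) 0, ∃ n : ℤ,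
      k * (π / M) = φ + n * (2 * π) := by
  have hM' : (0 : ℝ) < M := by exact_mod_cast hM
  have hp : 0 < π / M := by positivity
  have hMe : M * (π / M) = π := by field_simp
  have hN : (0 : ℤ) < 2 * M := by omega
  have e := Int.emod_add_mul_ediv k (2 * M)
  have l := Int.emod_nonneg k hN.ne'
  have u := Int.emod_lt_of_pos k hN
  set j := k % (2 * M)
  set q := k / (2 * M)
  have e' : (k : ℝ) = j + 2 * M * q := by rw [← e]; push_cast; ring
  rcases le_or_gt j 0 with hj | hj
  · have : j = 0 := le_antisymm hj l
    refine ⟨0, Or.inr ⟨?_, le_rfl⟩, q, ?_⟩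
    · have : (1 : ℝ) ≤ M := by exact_mod_cast hM
      nlinarith
    · rw [e', this]; push_cast; linear_combination 2 * q * hMe
  · rcases le_or_gt j M with hj2 | hj2
    · refine ⟨j * (π / M), Or.inl ⟨?_, ?_⟩, q, ?_⟩
      · have : (1 : ℝ) ≤ j := by exact_mod_cast hj
        nlinarith
      · have : (j : ℝ) ≤ M := by exact_mod_cast hj2
        nlinarith
      · rw [e']; linear_combination 2 * q * hMe
    · refine ⟨j * (π / M) - 2 * π, Or.inr ⟨?_, ?_⟩, q + 1, ?_⟩
      · have : (M : ℝ) + 1 ≤ j := by exact_mod_cast hj2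
        nlinarith
      · have : (j : ℝ) ≤ 2 * M := by exact_mod_cast u.le
        nlinarith
      · rw [e']; push_cast; linear_combination 2 * q * hMe

lemma dirCoord_add_int_mul_two_pi (θ : ℝ) (n : ℤ) :
    dirCoord (θ + n * (2 * π)) = dirCoord θ := by
  ext x; simp [dirCoord]

lemma dirCoord_le_of_angle_range {h : ℝ → ℝ} (hper : Function.Periodic h (2 * π)) {M : ℕ}
    (hM : 0 < M) {x : Plane} {θ : ℝ}
    (hx : ∀ φ ∈ Set.Icc (π / M) π ∪ Set.Icc (π / M - π) 0, dirCoord (θ + φ) x ≤ h (θ + φ))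
    (k : ℤ) : dirCoord (θ + k * (π / M)) x ≤ h (θ + k * (π / M)) := by
  obtain ⟨φ, hφ, n, e⟩ := exists_angle_repr hM k
  rw [e, ← add_assoc, dirCoord_add_int_mul_two_pi, hper.int_mul n (θ + φ)]
  exact hx φ hφ

lemma vertex_mem_polygon {h : ℝ → ℝ} (hper : Function.Periodic h (2 * π))
    (hs : AngleSublinear h) {M : ℕ} (hM : 2 ≤ M) (k : ℤ) :
    vertex h (k * (π / M)) (π / M) ∈ polygon h (π / M) := by
  intro j
  have hM' : (2 : ℝ) ≤ M := by exact_mod_cast hM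
  have hp : 0 < π / M := by positivity
  have hlt : π / M < π := div_lt_self pi_pos (by linarith)
  have := dirCoord_le_of_angle_range hper (by omega : 0 < M)
    (fun φ hφ => dirCoord_vertex_pos_le hs (k * (π / M)) hp hlt hφ) (j - k)
  rwa [show (k : ℝ) * (π / M) + ((j - k : ℤ) : ℝ) * (π / M) = j * (π / M) by push_cast; ring]
    at this

lemma vertex_neg_mem_polygon {h : ℝ → ℝ} (hper : Function.Periodic h (2 * π))
    (hs : AngleSublinear h) {M : ℕ} (hM : 2 ≤ M) (k : ℤ) :
    vertex h (k * (π / M)) (-(π / M)) ∈ polygon h (π / M) := by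
  intro j
  have hM' : (2 : ℝ) ≤ M := by exact_mod_cast hM
  have hp : 0 < π / M := by positivity
  have hlt : π / M < π := div_lt_self pi_pos (by linarith)
  obtain ⟨φ, hφ, n, e⟩ := exists_angle_repr (by omega : 0 < M) (k - j)
  have h1 := dirCoord_vertex_neg_le hs (k * (π / M)) hp hlt hφ
  have e2 : (j : ℝ) * (π / M) = k * (π / M) - φ + (-n : ℤ) * (2 * π) := by
    push_cast at e ⊢; linarith
  rw [e2, dirCoord_add_int_mul_two_pi, hper.int_mul (-n)]
  exact h1

end Polygon

section Triangle

/-- The triangle with vertices `0`, `p` and `q`. -/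
def triangle (p q : Plane) : Set Plane :=
  {x | ∃ a b : ℝ, 0 ≤ a ∧ 0 ≤ b ∧ a + b ≤ 1 ∧ x = a • p + b • q}

/-- The standard triangle in `ℝ × ℝ`. -/
def prodTriangle : Set (ℝ × ℝ) := {z : ℝ × ℝ | 0 ≤ z.1 ∧ 0 ≤ z.2 ∧ z.1 + z.2 ≤ 1}

lemma isCompact_prodTriangle : IsCompact prodTriangle := by
  have hcl : IsClosed prodTriangle := by
    unfold prodTriangle
    refine IsClosed.and ?_ (IsClosed.and ?_ ?_) <;>
      exact isClosed_le (by fun_prop) (by fun_prop)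
  refine (isCompact_Icc (a := ((0, 0) : ℝ × ℝ)) (b := (1, 1))).of_isClosed_subset hcl ?_
  rintro ⟨x, y⟩ ⟨h0, h1, h2⟩
  simp only at h0 h1 h2
  exact ⟨⟨h0, h1⟩, ⟨by linarith, by linarith⟩⟩

lemma volume_prodTriangle :
    volume prodTriangle = ENNReal.ofReal (1 / 2) := by
  rw [Measure.volume_eq_prod, Measure.prod_apply isCompact_prodTriangle.measurableSet]
  have hslice : ∀ x : ℝ, volume (Prod.mk x ⁻¹' prodTriangle) =
      (Set.Icc (0 : ℝ) 1).indicator (fun x => ENNReal.ofReal (1 - x)) x := by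
    intro x
    by_cases hx : x ∈ Set.Icc (0 : ℝ) 1
    · rw [Set.indicator_of_mem hx, ← sub_zero (1 - x), ← Real.volume_Icc]
      congr 1
      ext y
      simp only [prodTriangle, Set.mem_preimage, Set.mem_ofPred_eq, Set.mem_Icc]
      exact ⟨fun h => ⟨h.2.1, by linarith⟩, fun h => ⟨hx.1, h.1, by linarith⟩⟩
    · rw [Set.indicator_of_notMem hx]
      convert measure_empty (μ := (volume : Measure ℝ))
      ext y
      simp only [prodTriangle, Set.mem_preimage, Set.mem_ofPred_eq,
        Set.mem_empty_iff_false, iff_false]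
      exact fun h => hx ⟨h.1, by linarith⟩
  simp_rw [hslice]
  rw [lintegral_indicator measurableSet_Icc, ← ofReal_integral_eq_lintegral_ofReal]
  · rw [integral_Icc_eq_integral_Ioc, ← intervalIntegral.integral_of_le zero_le_one]
    congr 1
    rw [intervalIntegral.integral_sub (by simp) (by simp)]
    norm_num
  · exact (by fun_prop : Continuous fun x : ℝ => 1 - x).integrableOn_Icc
  · filter_upwards [ae_restrict_mem measurableSet_Icc] with x hx
    simpa using hx.2

lemma volume_plane_preimage (s : Set (ℝ × ℝ)) (hs : MeasurableSet s) :
    volume {x : Plane | (x 0, x 1) ∈ s} = volume s := by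
  have h := (volume_preserving_finTwoArrow ℝ).comp
    (EuclideanSpace.volume_preserving_symm_measurableEquiv_toLp (Fin 2))
  exact h.measure_preimage hs.nullMeasurableSet

lemma volume_triangle (p q : Plane) :
    volume (triangle p q) = ENNReal.ofReal (|p 0 * q 1 - p 1 * q 0| / 2) := by
  set A : Matrix (Fin 2) (Fin 2) ℝ := !![p 0, q 0; p 1, q 1] with hA
  have himg : triangle p q = Matrix.toEuclideanLin A ''
      {x : Plane | (x 0, x 1) ∈ prodTriangle} := by
    have key : ∀ x : Plane, Matrix.toEuclideanLin A x = x 0 • p + x 1 • q := by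
      intro x
      ext i
      fin_cases i <;>
        simp [hA, Matrix.toLpLin_apply, dotProduct, Fin.sum_univ_two] <;> ring
    ext x
    constructor
    · rintro ⟨a, b, ha, hb, hab, rfl⟩
      refine ⟨!₂[a, b], ?_, ?_⟩
      · simpa [prodTriangle] using ⟨ha, hb, hab⟩
      · rw [key]; simp
    · rintro ⟨y, ⟨h0, h1, h2⟩, rfl⟩
      exact ⟨y 0, y 1, h0, h1, h2, key y⟩
  have hdet : LinearMap.det (Matrix.toEuclideanLin A) = p 0 * q 1 - p 1 * q 0 := by
    rw [Matrix.toEuclideanLin_eq_toLin_orthonormal, LinearMap.det_toLin, Matrix.det_fin_two]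
    simp [hA]; ring
  rw [himg, Measure.addHaar_image_linearMap, hdet,
    volume_plane_preimage _ isCompact_prodTriangle.measurableSet,
    volume_prodTriangle, ← ENNReal.ofReal_mul (abs_nonneg _)]
  congr 1
  ring

lemma isCompact_triangle (p q : Plane) : IsCompact (triangle p q) := by
  have himg : triangle p q = (fun z : ℝ × ℝ => z.1 • p + z.2 • q) ''
      prodTriangle := by
    ext x
    constructor
    · rintro ⟨a, b, ha, hb, hab, rfl⟩
      exact ⟨(a, b), ⟨ha, hb, hab⟩, rfl⟩
    · rintro ⟨z, ⟨h0, h1, h2⟩, rfl⟩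
      exact ⟨z.1, z.2, h0, h1, h2, rfl⟩
  rw [himg]
  exact isCompact_prodTriangle.image (by fun_prop)

end Triangle

section PolygonArea

/-- The triangle spanned by the origin and the edge with normal angle `θ`. -/
def edgeTriangle (h : ℝ → ℝ) (ε θ : ℝ) : Set Plane :=
  triangle (vertex h θ (-ε)) (vertex h θ ε)

lemma volume_edgeTriangle (h : ℝ → ℝ) (ε θ : ℝ) :
    volume (edgeTriangle h ε θ) = ENNReal.ofReal (|h θ * edge h ε θ / sin ε| / 2) := by
  rw [edgeTriangle, volume_triangle]
  congr 3
  simp only [vertex, unitDir, edge, cos_add_pi_div_two, sin_add_pi_div_two, cos_neg, sin_neg,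
    ← sub_eq_add_neg, PiLp.add_apply, PiLp.smul_apply, smul_eq_mul, Matrix.cons_val_zero,
    Matrix.cons_val_one]
  by_cases hs : sin ε = 0
  · simp [hs]; ring
  · field_simp
    linear_combination
      (sin ε * h θ * (h (θ + ε) + h (θ - ε) - 2 * cos ε * h θ)) * sin_sq_add_cos_sq θ

lemma dirCoord_vertex_self (h : ℝ → ℝ) (θ δ : ℝ) (hδ : sin δ ≠ 0) :
    dirCoord θ (vertex h θ δ) = h θ := by
  have := dirCoord_vertex h θ δ 0 hδ
  simp only [add_zero, sub_zero, sin_zero, mul_zero] at this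
  exact mul_right_cancel₀ hδ this

variable {h : ℝ → ℝ} {M : ℕ}

lemma sin_pi_div_pos (hM : 2 ≤ M) : 0 < sin (π / M) := by
  have hM' : (2 : ℝ) ≤ M := by exact_mod_cast hM
  exact sin_pos_of_pos_of_lt_pi (by positivity) (div_lt_self pi_pos (by linarith))

lemma exists_gauge_of_mem_edgeTriangle (hper : Function.Periodic h (2 * π))
    (hs : AngleSublinear h) (hM : 2 ≤ M) (k : ℤ) {x : Plane}
    (hx : x ∈ edgeTriangle h (π / M) (k * (π / M))) :
    ∃ ρ, 0 ≤ ρ ∧ ρ ≤ 1 ∧ dirCoord (k * (π / M)) x = ρ * h (k * (π / M)) ∧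
      ∀ j : ℤ, dirCoord (j * (π / M)) x ≤ ρ * h (j * (π / M)) := by
  obtain ⟨a, b, ha, hb, hab, rfl⟩ := hx
  have hsin := sin_pi_div_pos hM
  refine ⟨a + b, by positivity, hab, ?_, fun j => ?_⟩
  · rw [dirCoord_add, dirCoord_smul, dirCoord_smul, dirCoord_vertex_self _ _ _ hsin.ne',
      dirCoord_vertex_self _ _ _ (by simpa using hsin.ne')]
    ring
  · rw [dirCoord_add, dirCoord_smul, dirCoord_smul, add_mul]
    exact add_le_add
      (mul_le_mul_of_nonneg_left (vertex_neg_mem_polygon hper hs hM k j) ha)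
      (mul_le_mul_of_nonneg_left (vertex_mem_polygon hper hs hM k j) hb)

lemma edgeTriangle_subset_polygon (hper : Function.Periodic h (2 * π)) (hs : AngleSublinear h)
    (h0 : ∀ θ, 0 ≤ h θ) (hM : 2 ≤ M) (k : ℤ) :
    edgeTriangle h (π / M) (k * (π / M)) ⊆ polygon h (π / M) := by
  intro x hx j
  obtain ⟨ρ, -, hρ1, -, hj⟩ := exists_gauge_of_mem_edgeTriangle hper hs hM k hx
  exact (hj j).trans (mul_le_of_le_one_left (h0 _) hρ1)

lemma eq_dirCoord_smul_add (θ : ℝ) (x : Plane) :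
    x = dirCoord θ x • unitDir θ + dirCoord (θ + π / 2) x • unitDir (θ + π / 2) := by
  ext i
  fin_cases i
  · simp [dirCoord, unitDir, cos_add_pi_div_two, sin_add_pi_div_two]
    linear_combination -(x 0) * sin_sq_add_cos_sq θ
  · simp [dirCoord, unitDir, cos_add_pi_div_two, sin_add_pi_div_two]
    linear_combination -(x 1) * sin_sq_add_cos_sq θ

lemma mem_edgeTriangle {ε θ ρ : ℝ} (hsin : 0 < sin ε) {x : Plane} (hρ0 : 0 ≤ ρ) (hρ1 : ρ ≤ 1)
    (hx : dirCoord θ x = ρ * h θ) (hp : dirCoord (θ + ε) x ≤ ρ * h (θ + ε))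
    (hm : dirCoord (θ - ε) x ≤ ρ * h (θ - ε)) : x ∈ edgeTriangle h ε θ := by
  rw [dirCoord_angle_add, hx] at hp
  rw [sub_eq_add_neg, dirCoord_angle_add, hx, cos_neg, sin_neg, ← sub_eq_add_neg] at hm
  set t := dirCoord (θ + π / 2) x with ht
  set β := (h (θ + ε) - cos ε * h θ) / sin ε with hβ
  set α := (h (θ - ε) - cos ε * h θ) / -sin ε with hα
  have hβ' : β * sin ε = h (θ + ε) - cos ε * h θ := by rw [hβ]; field_simp
  have hα' : α * sin ε = -(h (θ - ε) - cos ε * h θ) := by rw [hα]; field_simp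
  have h1 : t ≤ ρ * β := by
    refine le_of_mul_le_mul_right ?_ hsin
    rw [mul_assoc, hβ']; linarith
  have h2 : ρ * α ≤ t := by
    refine le_of_mul_le_mul_right ?_ hsin
    rw [mul_assoc, hα']; linarith
  have key : ∀ a b : ℝ, a + b = ρ → a * α + b * β = t →
      x = a • vertex h θ (-ε) + b • vertex h θ ε := by
    intro a b hab hT
    rw [eq_dirCoord_smul_add θ x, hx, ← ht, ← hT, ← hab]
    simp only [vertex, cos_neg, sin_neg, ← sub_eq_add_neg]
    rw [← hα, ← hβ]
    module
  rcases (h2.trans h1).eq_or_lt with he | hlt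
  · refine ⟨ρ, 0, hρ0, le_rfl, by linarith, key ρ 0 (by ring) ?_⟩
    linarith
  · have hd : 0 < β - α := by
      by_contra hc
      nlinarith
    refine ⟨(ρ * β - t) / (β - α), (t - ρ * α) / (β - α), div_nonneg (by linarith) hd.le,
      div_nonneg (by linarith) hd.le, ?_, key _ _ ?_ ?_⟩
    · rw [← add_div, div_le_iff₀ hd]; nlinarith
    · field_simp; ring
    · field_simp; ring

lemma exists_dirCoord_pos (hM : 2 ≤ M) {x : Plane} (hx : x ≠ 0) :
    ∃ k ∈ Finset.range (2 * M), 0 < dirCoord ((k : ℤ) * (π / M)) x := by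
  by_contra! hcon
  have hM0 : (M : ℝ) ≠ 0 := by positivity
  have a0 := hcon 0 (by simp; omega)
  have a1 := hcon M (by simp; omega)
  have b0 := hcon 1 (by simp; omega)
  have b1 := hcon (M + 1) (by simp; omega)
  have e : ((M + 1 : ℕ) : ℤ) * (π / M) = π / M + π := by push_cast; field_simp; ring
  have e' : ((M : ℕ) : ℤ) * (π / M) = π := by push_cast; field_simp
  rw [e] at b1
  rw [e'] at a1
  simp only [dirCoord, Nat.cast_zero, Int.cast_zero, zero_mul, cos_zero, sin_zero, cos_pi, sin_pi,
    Nat.cast_one, Int.cast_one, one_mul, cos_add_pi, sin_add_pi] at a0 a1 b0 b1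
  have x0 : x 0 = 0 := by linarith
  have hsin := sin_pi_div_pos hM
  rw [x0] at b0 b1
  have x1 : x 1 * sin (π / M) = 0 := by linarith
  have x1 : x 1 = 0 := (mul_eq_zero.mp x1).resolve_right hsin.ne'
  apply hx
  ext i
  fin_cases i <;> simp [x0, x1]

lemma polygon_eq_iUnion (hper : Function.Periodic h (2 * π)) (hs : AngleSublinear h)
    (h0 : ∀ θ, 0 ≤ h θ) (hM : 2 ≤ M) :
    polygon h (π / M) =
      ⋃ k ∈ Finset.range (2 * M), edgeTriangle h (π / M) ((k : ℤ) * (π / M)) := by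
  refine subset_antisymm (fun x hx => ?_)
    (Set.iUnion₂_subset fun k _ => edgeTriangle_subset_polygon hper hs h0 hM k)
  by_cases hx0 : x = 0
  · refine Set.mem_iUnion₂.mpr ⟨0, by simp; omega, 0, 0, le_rfl, le_rfl, by norm_num, ?_⟩
    simp [hx0]
  have hM0 : (M : ℝ) ≠ 0 := by positivity
  obtain ⟨j, hj, hjpos⟩ := exists_dirCoord_pos hM hx0
  obtain ⟨k, hk, hmax⟩ := Finset.exists_max_image (Finset.range (2 * M))
    (fun k : ℕ => dirCoord ((k : ℤ) * (π / M)) x / h ((k : ℤ) * (π / M))) ⟨j, hj⟩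
  set ρ := dirCoord ((k : ℤ) * (π / M)) x / h ((k : ℤ) * (π / M)) with hρ
  have hρpos : 0 < ρ := (div_pos hjpos (hjpos.trans_le (hx j))).trans_le (hmax j hj)
  have hkpos : 0 < h ((k : ℤ) * (π / M)) := by
    refine (h0 _).lt_of_ne fun hc => ?_
    rw [hρ, ← hc, div_zero] at hρpos
    exact hρpos.false
  have hρ1 : ρ ≤ 1 := (div_le_one hkpos).mpr (hx k)
  have hall : ∀ i : ℤ, dirCoord (i * (π / M)) x ≤ ρ * h (i * (π / M)) := by
    intro i
    have hN : (0 : ℤ) < 2 * M := by omega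
    have l := Int.emod_nonneg i hN.ne'
    have u := Int.emod_lt_of_pos i hN
    have e := Int.emod_add_mul_ediv i (2 * M)
    obtain ⟨m, hm⟩ := Int.eq_ofNat_of_zero_le l
    rw [hm] at u e
    have e2 : (i : ℝ) * (π / M) = ((m : ℕ) : ℤ) * (π / M) + (i / (2 * M) : ℤ) * (2 * π) := by
      conv_lhs => rw [← e]
      push_cast
      field_simp
    rw [e2, dirCoord_add_int_mul_two_pi, hper.int_mul]
    have hmm := hmax m (by simp; omega)
    rcases (h0 ((m : ℤ) * (π / M))).eq_or_lt with hz | hz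
    · rw [← hz, mul_zero, hz]; exact hx m
    · exact (div_le_iff₀ hz).mp hmm
  refine Set.mem_iUnion₂.mpr ⟨k, hk, mem_edgeTriangle (sin_pi_div_pos hM) hρpos.le hρ1 ?_ ?_ ?_⟩
  · exact (div_mul_cancel₀ _ hkpos.ne').symm
  · have := hall (k + 1)
    rwa [show ((k + 1 : ℤ) : ℝ) * (π / M) = (k : ℤ) * (π / M) + π / M by push_cast; ring] at this
  · have := hall (k - 1)
    rwa [show ((k - 1 : ℤ) : ℝ) * (π / M) = (k : ℤ) * (π / M) - π / M by push_cast; ring] at this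

lemma volume_dirCoord_eq_zero {a b : ℝ} (θ φ : ℝ) (ha : 0 < a) (hb : 0 < b)
    (hne : unitDir θ ≠ unitDir φ) :
    volume {x : Plane | a * dirCoord θ x = b * dirCoord φ x} = 0 := by
  set v : Plane := a • unitDir θ - b • unitDir φ with hv
  have hset : {x : Plane | a * dirCoord θ x = b * dirCoord φ x} =
      ((ℝ ∙ v)ᗮ : Submodule ℝ Plane) := by
    ext x
    rw [SetLike.mem_coe, Submodule.mem_orthogonal_singleton_iff_inner_left, hv, inner_sub_right,
      inner_smul_right, inner_smul_right, inner_unitDir, inner_unitDir, sub_eq_zero]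
    rfl
  rw [hset]
  refine Measure.addHaar_submodule _ _ fun htop => ?_
  rw [Submodule.orthogonal_eq_top_iff, Submodule.span_singleton_eq_bot, hv, sub_eq_zero] at htop
  have hn := congrArg norm htop
  rw [norm_smul, norm_smul, norm_unitDir, norm_unitDir, norm_of_nonneg ha.le,
    norm_of_nonneg hb.le, mul_one, mul_one] at hn
  rw [hn] at htop
  exact hne (smul_right_injective _ hb.ne' htop)

lemma unitDir_injOn : Set.InjOn unitDir (Set.Ico 0 (2 * π)) := by
  intro θ hθ φ hφ he
  have h0 : cos θ = cos φ := by simpa [unitDir] using congrArg (fun x : Plane => x 0) he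
  have h1 : sin θ = sin φ := by simpa [unitDir] using congrArg (fun x : Plane => x 1) he
  have hang : (θ : Real.Angle) = φ := Real.Angle.cos_sin_inj h0 h1
  rw [Real.Angle.angle_eq_iff_two_pi_dvd_sub] at hang
  obtain ⟨n, hn⟩ := hang
  have hθ' := (toIcoMod_eq_self two_pi_pos (a := 0)).mpr (by simpa using hθ)
  have hφ' := (toIcoMod_eq_self two_pi_pos (a := 0)).mpr (by simpa using hφ)
  rw [← hθ', ← hφ', sub_eq_iff_eq_add'.mp hn,
    show 2 * π * n = n • (2 * π) by rw [zsmul_eq_mul, mul_comm], toIcoMod_add_zsmul]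

lemma aedisjoint_edgeTriangle (hper : Function.Periodic h (2 * π)) (hs : AngleSublinear h)
    (h0 : ∀ θ, 0 ≤ h θ) (hM : 2 ≤ M) {k j : ℕ} (hk : k < 2 * M) (hj : j < 2 * M) (hkj : k ≠ j) :
    AEDisjoint volume (edgeTriangle h (π / M) ((k : ℤ) * (π / M)))
      (edgeTriangle h (π / M) ((j : ℤ) * (π / M))) := by
  have null : ∀ {i : ℕ}, h ((i : ℤ) * (π / M)) = 0 →
      volume (edgeTriangle h (π / M) ((i : ℤ) * (π / M))) = 0 := by
    intro i hi
    rw [volume_edgeTriangle, hi]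
    simp
  rcases (h0 ((k : ℤ) * (π / M))).eq_or_lt with hz | hkpos
  · exact measure_mono_null Set.inter_subset_left (null hz.symm)
  rcases (h0 ((j : ℤ) * (π / M))).eq_or_lt with hz | hjpos
  · exact measure_mono_null Set.inter_subset_right (null hz.symm)
  have hM0 : (0 : ℝ) < M := by positivity
  have hmem : ∀ {i : ℕ}, i < 2 * M → ((i : ℤ) : ℝ) * (π / M) ∈ Set.Ico 0 (2 * π) := by
    intro i hi
    have : (i : ℝ) < 2 * M := by exact_mod_cast hi
    refine ⟨by push_cast; positivity, ?_⟩
    rw [← mul_div_assoc, div_lt_iff₀ hM0]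
    push_cast
    nlinarith [pi_pos]
  have hne : unitDir ((k : ℤ) * (π / M)) ≠ unitDir ((j : ℤ) * (π / M)) := by
    intro he
    have := unitDir_injOn (hmem hk) (hmem hj) he
    have := mul_right_cancel₀ (by positivity) this
    exact hkj (by exact_mod_cast this)
  refine measure_mono_null (fun x hx => ?_) (volume_dirCoord_eq_zero _ _ hjpos hkpos hne)
  obtain ⟨ρ, -, -, hρ, hρ'⟩ := exists_gauge_of_mem_edgeTriangle hper hs hM k hx.1
  obtain ⟨σ, -, -, hσ, hσ'⟩ := exists_gauge_of_mem_edgeTriangle hper hs hM j hx.2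
  have h1 := hρ' j
  have h2 := hσ' k
  rw [hσ] at h1
  rw [hρ] at h2
  have : ρ = σ := le_antisymm (le_of_mul_le_mul_right h2 hkpos) (le_of_mul_le_mul_right h1 hjpos)
  show _ * _ = _ * _
  rw [hρ, hσ, this]
  ring

lemma pi_div_le_pi_div_two (hM : 2 ≤ M) : π / M ≤ π / 2 := by
  have hM' : (2 : ℝ) ≤ M := by exact_mod_cast hM
  exact div_le_div_of_nonneg_left pi_pos.le two_pos hM'

lemma area_polygon (hper : Function.Periodic h (2 * π)) (hs : AngleSublinear h)
    (h0 : ∀ θ, 0 ≤ h θ) (hM : 2 ≤ M) :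
    area (polygon h (π / M)) = ∑ k ∈ Finset.range (2 * M),
      h (k * (π / M)) * edge h (π / M) (k * (π / M)) / sin (π / M) / 2 := by
  have hsin := sin_pi_div_pos hM
  rw [area, polygon_eq_iUnion hper hs h0 hM, measure_biUnion_finset₀,
    ENNReal.toReal_sum]
  · refine Finset.sum_congr rfl fun k _ => ?_
    have := hs.edge_nonneg (by positivity) (pi_div_le_pi_div_two hM) (k * (π / M))
    have := h0 (k * (π / M))
    rw [volume_edgeTriangle, ENNReal.toReal_ofReal (by positivity)]
    push_cast
    rw [abs_of_nonneg (by positivity)]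
  · exact fun k _ => (isCompact_triangle _ _).measure_lt_top.ne
  · intro k hk j hj hkj
    exact aedisjoint_edgeTriangle hper hs h0 hM (by simpa using hk) (by simpa using hj) hkj
  · exact fun k _ => (isCompact_triangle _ _).measurableSet.nullMeasurableSet

end PolygonArea

section Approximation

variable {K : Set Plane}

lemma subset_polygon_supp (hKc : IsCompact K) (ε : ℝ) : K ⊆ polygon (supp K) ε :=
  fun _ hx _ => dirCoord_le_supp hKc _ hx

lemma polygon_supp_subset_cthickening (hK : Convex ℝ K) (hKc : IsCompact K) (hKne : K.Nonempty)
    {ε : ℝ} (h0 : 0 < ε) (hε : ε ≤ π / 3) :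
    polygon (supp K) ε ⊆ Metric.cthickening (2 * Metric.diam K * ε) K := by
  intro x hx
  obtain ⟨y, hy, hmin⟩ := exists_norm_eq_iInf_of_complete_convex hKne hKc.isComplete hK x
  have hproj := (norm_eq_iInf_iff_real_inner_le_zero hK hy).mp hmin
  obtain ⟨θ, hθ⟩ := exists_unitDir_eq (x - y)
  set d := ‖x - y‖ with hd
  refine Metric.mem_cthickening_of_dist_le x y _ _ hy ?_
  rw [dist_eq_norm, ← hd]
  have hD : 0 ≤ Metric.diam K := Metric.diam_nonneg
  rcases (norm_nonneg (x - y)).eq_or_lt with hz | hdpos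
  · rw [hd, ← hz]; positivity
  have hnormal : ∀ z ∈ K, dirCoord θ (z - y) ≤ 0 := by
    intro z hz
    have := hproj z hz
    rw [hθ, real_inner_comm, inner_smul_right, inner_unitDir] at this
    exact nonpos_of_mul_nonpos_right this hdpos
  set k := ⌊θ / ε⌋
  have hk1 : k * ε ≤ θ := (le_div_iff₀ h0).mp (Int.floor_le _)
  have hk2 : θ < (k + 1) * ε := (div_lt_iff₀ h0).mp (Int.lt_floor_add_one _)
  obtain ⟨δ, hδ⟩ : ∃ δ, k * ε = θ + δ := ⟨k * ε - θ, by ring⟩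
  have hδabs : |δ| ≤ ε := abs_le.mpr ⟨by linarith, by linarith⟩
  have hcos : 1 / 2 ≤ cos δ := by
    rw [← cos_abs δ, ← cos_pi_div_three]
    exact cos_le_cos_of_nonneg_of_le_pi (abs_nonneg _) (by linarith [pi_pos]) (hδabs.trans hε)
  obtain ⟨z, hz, hzs⟩ := exists_dirCoord_eq_supp hKc hKne (k * ε)
  have hle := hx k
  rw [← hzs, hδ] at hle
  have hxy : dirCoord (θ + δ) (x - y) = d * cos δ := by
    rw [hθ, dirCoord_smul, dirCoord_unitDir, add_sub_cancel_left]
  have hzy := dirCoord_angle_add θ δ (z - y)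
  rw [dirCoord_sub] at hxy hzy
  have h1 : cos δ * dirCoord θ (z - y) ≤ 0 :=
    mul_nonpos_of_nonneg_of_nonpos (by linarith) (hnormal z hz)
  have h2 : sin δ * dirCoord (θ + π / 2) (z - y) ≤ ε * Metric.diam K := by
    refine (le_abs_self _).trans ?_
    rw [abs_mul]
    refine mul_le_mul (abs_sin_le_abs.trans hδabs) ((abs_dirCoord_le _ _).trans ?_)
      (abs_nonneg _) h0.le
    rw [← dist_eq_norm]
    exact Metric.dist_le_diam_of_mem hKc.isBounded hz hy
  nlinarith

lemma tendsto_area_polygon_supp (hK : Convex ℝ K) (hKc : IsCompact K) (hKne : K.Nonempty) :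
    Tendsto (fun M : ℕ => area (polygon (supp K) (π / M))) atTop (𝓝 (area K)) := by
  have hε : Tendsto (fun M : ℕ => π / (M : ℝ)) atTop (𝓝 0) :=
    tendsto_const_div_atTop_nhds_zero_nat π
  have hδ : Tendsto (fun M : ℕ => 2 * Metric.diam K * (π / (M : ℝ))) atTop (𝓝 0) := by
    simpa using hε.const_mul (2 * Metric.diam K)
  refine (ENNReal.tendsto_toReal hKc.measure_lt_top.ne).comp ?_
  refine tendsto_of_tendsto_of_tendsto_of_le_of_le' tendsto_const_nhds
    ((tendsto_measure_cthickening_of_isCompact hKc).comp hδ)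
    (Eventually.of_forall fun M => measure_mono (subset_polygon_supp hKc _)) ?_
  filter_upwards [eventually_ge_atTop 3] with M hM
  have hM' : (3 : ℝ) ≤ M := by exact_mod_cast hM
  exact measure_mono (polygon_supp_subset_cthickening hK hKc hKne (by positivity)
    (div_le_div_of_nonneg_left pi_pos.le three_pos hM'))

end Approximation

section DiscreteMixedArea

/-- The mixed area of the polygons with `2 * M` equally spaced normals and support numbers given by
`f` and `g`. -/
noncomputable def polygonForm (M : ℕ) (f g : ℝ → ℝ) : ℝ :=
  ∑ k ∈ Finset.range (2 * M), f (k * (π / M)) * edge g (π / M) (k * (π / M)) / sin (π / M) / 2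

variable {M : ℕ}

lemma sum_shift_one {F : ℝ → ℝ} (hF : Function.Periodic F (2 * π)) (hM : 0 < M) :
    ∑ k ∈ Finset.range (2 * M), F (k * (π / M) + π / M) =
      ∑ k ∈ Finset.range (2 * M), F (k * (π / M)) := by
  have hM0 : (M : ℝ) ≠ 0 := by positivity
  have h := Finset.sum_range_sub (fun k : ℕ => F (k * (π / M))) (2 * M)
  have e : ((2 * M : ℕ) : ℝ) * (π / M) = 0 + 2 * π := by push_cast; field_simp; ring
  rw [e, hF 0, Nat.cast_zero, zero_mul, sub_self, Finset.sum_sub_distrib, sub_eq_zero] at h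
  rw [← h]
  refine Finset.sum_congr rfl fun k _ => ?_
  push_cast
  ring_nf

lemma sum_shift {F : ℝ → ℝ} (hF : Function.Periodic F (2 * π)) (hM : 0 < M) (j : ℕ) :
    ∑ k ∈ Finset.range (2 * M), F (j * (π / M) + k * (π / M)) =
      ∑ k ∈ Finset.range (2 * M), F (k * (π / M)) := by
  induction j with
  | zero => simp
  | succ j ih =>
    have hF' : Function.Periodic (fun φ => F (j * (π / M) + φ)) (2 * π) := fun φ => by
      simp only [← add_assoc, hF (j * (π / M) + φ)]
    rw [← ih, ← sum_shift_one hF' hM]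
    refine Finset.sum_congr rfl fun k _ => ?_
    push_cast
    ring_nf

lemma sum_mul_edge_comm {f g : ℝ → ℝ} (hf : Function.Periodic f (2 * π))
    (hg : Function.Periodic g (2 * π)) (hM : 0 < M) :
    ∑ k ∈ Finset.range (2 * M), f (k * (π / M)) * edge g (π / M) (k * (π / M)) =
      ∑ k ∈ Finset.range (2 * M), g (k * (π / M)) * edge f (π / M) (k * (π / M)) := by
  have shift : ∀ {u v : ℝ → ℝ}, Function.Periodic u (2 * π) → Function.Periodic v (2 * π) →
      ∑ k ∈ Finset.range (2 * M), u (k * (π / M) + π / M) * v (k * (π / M)) =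
        ∑ k ∈ Finset.range (2 * M), u (k * (π / M)) * v (k * (π / M) - π / M) := by
    intro u v hu hv
    have hF : Function.Periodic (fun φ => u φ * v (φ - π / M)) (2 * π) := fun φ => by
      simp only [hu φ, add_sub_right_comm, hv (φ - π / M)]
    simpa using sum_shift_one hF hM
  have h1 := shift hf hg
  have h2 := shift hg hf
  simp only [edge, mul_add, mul_sub, Finset.sum_add_distrib, Finset.sum_sub_distrib]
  simp only [mul_comm (g _) (f _), mul_comm (f _) (2 * cos (π / M) * g _),
    mul_comm (g _) (2 * cos (π / M) * f _), mul_right_comm _ (g _) (f _)] at *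
  linarith

lemma polygonForm_comm {f g : ℝ → ℝ} (hf : Function.Periodic f (2 * π))
    (hg : Function.Periodic g (2 * π)) (hM : 0 < M) : polygonForm M f g = polygonForm M g f := by
  simp only [polygonForm, ← Finset.sum_div, sum_mul_edge_comm hf hg hM]

lemma polygonForm_add_left (f₁ f₂ g : ℝ → ℝ) :
    polygonForm M (f₁ + f₂) g = polygonForm M f₁ g + polygonForm M f₂ g := by
  simp only [polygonForm, ← Finset.sum_add_distrib, Pi.add_apply]
  exact Finset.sum_congr rfl fun k _ => by ring

lemma polygonForm_add_right (f g₁ g₂ : ℝ → ℝ) :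
    polygonForm M f (g₁ + g₂) = polygonForm M f g₁ + polygonForm M f g₂ := by
  simp only [polygonForm, ← Finset.sum_add_distrib, edge, Pi.add_apply]
  exact Finset.sum_congr rfl fun k _ => by ring

/-- Up to scaling, the Green function of `1 + d²/dθ²` on the circle with a pole at `0`, expressing
the value of a support function, relative to the Steiner point, by its curvature. -/
noncomputable def green (φ : ℝ) : ℝ := π / 2 - (π - φ) * sin φ + cos φ

lemma mul_sin_add_cos_le {y : ℝ} (h0 : 0 ≤ y) (h1 : y ≤ π) : y * sin y + cos y ≤ π / 2 := by
  rcases le_total y (π / 2) with h | h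
  · have h2 : cos y ≤ π / 2 - y := by
      rw [← sin_pi_div_two_sub]; exact sin_le (by linarith)
    nlinarith [sin_le_one y]
  · obtain ⟨z, rfl⟩ : ∃ z, y = z + π / 2 := ⟨y - π / 2, by ring⟩
    rw [sin_add_pi_div_two, cos_add_pi_div_two]
    have hz : z * cos z ≤ sin z := by
      rcases (show z ≤ π / 2 by linarith).eq_or_lt with rfl | hlt
      · simp
      · have hc : 0 < cos z := cos_pos_of_mem_Ioo ⟨by linarith [pi_pos], hlt⟩
        have := le_tan (by linarith) hlt
        rwa [tan_eq_sin_div_cos, le_div_iff₀ hc] at this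
    nlinarith [cos_le_one z, pi_pos]

lemma green_nonneg {φ : ℝ} (h0 : 0 ≤ φ) (h1 : φ ≤ 2 * π) : 0 ≤ green φ := by
  have key : ∀ y, |y| ≤ π → y * sin y + cos y ≤ π / 2 := by
    intro y hy
    have := mul_sin_add_cos_le (abs_nonneg y) hy
    rcases abs_cases y with ⟨h, -⟩ | ⟨h, -⟩ <;> rw [h] at this
    · exact this
    · simpa using this
  have := key (π - φ) (abs_le.mpr ⟨by linarith, by linarith⟩)
  rw [sin_pi_sub, cos_pi_sub] at this
  unfold green
  linarith

lemma edge_green (ε φ : ℝ) :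
    edge green ε φ = π * (1 - cos ε) + 2 * ε * sin ε * cos φ := by
  simp only [edge, green, sin_add, cos_add, sin_sub, cos_sub]
  ring

lemma sum_green_mul_edge {h : ℝ → ℝ} (hper : Function.Periodic h (2 * π)) (hM : 0 < M) :
    ∑ k ∈ Finset.range (2 * M), green (k * (π / M)) * edge h (π / M) (k * (π / M)) =
      ∑ k ∈ Finset.range (2 * M), h (k * (π / M)) * edge green (π / M) (k * (π / M)) -
        2 * π * sin (π / M) * h 0 := by
  have hM0 : (M : ℝ) ≠ 0 := by positivity
  have e : ((2 * M : ℕ) : ℝ) * (π / M) = 0 + 2 * π := by push_cast; field_simp; ring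
  have t := Finset.sum_range_sub (fun k : ℕ =>
    green (k * (π / M) - π / M) * h (k * (π / M)) -
      green (k * (π / M)) * h (k * (π / M) - π / M)) (2 * M)
  simp only [e, add_sub_right_comm, hper _, Nat.cast_zero, zero_mul] at t
  have g1 : green (0 - π / M + 2 * π) = green (0 - π / M) - 2 * π * sin (π / M) := by
    simp only [green, zero_sub, sin_add_two_pi, cos_add_two_pi, sin_neg]; ring
  have g2 : green (0 + 2 * π) = green 0 := by simp [green]
  rw [g1, g2] at t
  have key : ∑ k ∈ Finset.range (2 * M), (green (k * (π / M)) * edge h (π / M) (k * (π / M)) -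
      h (k * (π / M)) * edge green (π / M) (k * (π / M))) = -(2 * π * sin (π / M) * h 0) := by
    refine (Finset.sum_congr rfl fun k _ => ?_).trans (t.trans (by ring))
    have e1 : ((k + 1 : ℕ) : ℝ) * (π / M) = k * (π / M) + π / M := by push_cast; ring
    rw [e1, add_sub_cancel_right, edge, edge]
    ring
  rw [Finset.sum_sub_distrib] at key
  linarith

/-- The value of `h` at `θ` is at most a quarter of the discrete perimeter plus the support function
of the discrete Steiner point. -/
lemma mul_sin_le_sum {h : ℝ → ℝ} (hper : Function.Periodic h (2 * π)) (hs : AngleSublinear h)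
    (hM : 2 ≤ M) (j : ℕ) :
    h (j * (π / M)) * sin (π / M) ≤ ∑ k ∈ Finset.range (2 * M), h (k * (π / M)) *
      ((1 - cos (π / M)) / 2 + π / M * sin (π / M) / π * cos (k * (π / M) - j * (π / M))) := by
  set θ := (j : ℝ) * (π / M) with hθ
  have hM0 : (0 : ℝ) < M := by positivity
  have hper' : Function.Periodic (fun φ => h (θ + φ)) (2 * π) := fun φ => by
    simp only [← add_assoc, hper (θ + φ)]
  have hpos : 0 ≤ ∑ k ∈ Finset.range (2 * M),
      green (k * (π / M)) * edge (fun φ => h (θ + φ)) (π / M) (k * (π / M)) := by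
    refine Finset.sum_nonneg fun k hk => mul_nonneg (green_nonneg (by positivity) ?_) ?_
    · have : (k : ℝ) ≤ 2 * M := by exact_mod_cast (Finset.mem_range.mp hk).le
      rw [← mul_div_assoc, div_le_iff₀ hM0]
      nlinarith [pi_pos]
    · have := hs.edge_nonneg (by positivity) (pi_div_le_pi_div_two hM) (θ + k * (π / M))
      simpa only [edge, add_assoc, add_sub_assoc] using this
  rw [sum_green_mul_edge hper' (by omega)] at hpos
  simp only [edge_green, add_zero] at hpos
  have hF : Function.Periodic (fun φ => h φ *
      ((1 - cos (π / M)) / 2 + π / M * sin (π / M) / π * cos (φ - θ))) (2 * π) := fun φ => by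
    simp only [hper φ, add_sub_right_comm, cos_add_two_pi]
  have hshift := sum_shift hF (by omega : 0 < M) j
  simp only [← hθ, add_sub_cancel_left] at hshift
  rw [← hshift]
  have e : ∑ k ∈ Finset.range (2 * M), h (θ + k * (π / M)) *
      (π * (1 - cos (π / M)) + 2 * (π / M) * sin (π / M) * cos (k * (π / M))) =
      2 * π * ∑ k ∈ Finset.range (2 * M), h (θ + k * (π / M)) *
        ((1 - cos (π / M)) / 2 + π / M * sin (π / M) / π * cos (k * (π / M))) := by
    rw [Finset.mul_sum]
    refine Finset.sum_congr rfl fun k _ => ?_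
    field_simp
  rw [e] at hpos
  refine le_of_mul_le_mul_left ?_ two_pi_pos
  linarith

lemma sum_edge_mul_cos {h : ℝ → ℝ} (hper : Function.Periodic h (2 * π)) (hM : 0 < M) (θ : ℝ) :
    ∑ k ∈ Finset.range (2 * M), edge h (π / M) (k * (π / M)) * cos (θ - k * (π / M)) = 0 := by
  have hcos : Function.Periodic (fun φ => cos (θ - φ)) (2 * π) := fun φ => by
    simp only [← sub_sub, cos_sub_two_pi]
  have := sum_mul_edge_comm hper hcos hM
  simp only [mul_comm (cos _)] at this
  rw [← this]
  refine Finset.sum_eq_zero fun k _ => ?_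
  simp only [edge, ← sub_sub, sub_sub_eq_add_sub, add_sub_right_comm θ, cos_add, cos_sub _ (π / M)]
  ring

lemma polygonForm_le {f g : ℝ → ℝ} (hf : Function.Periodic f (2 * π)) (hfs : AngleSublinear f)
    (hg : Function.Periodic g (2 * π)) (hgs : AngleSublinear g) (hM : 2 ≤ M) :
    2 * polygonForm M g f ≤ polygonForm M (fun _ => 1) f * polygonForm M g (fun _ => 1) := by
  have hM0 : 0 < M := by omega
  have hsin := sin_pi_div_pos hM
  set s := sin (π / M) with hs
  set a : ℕ → ℝ := fun k => edge f (π / M) (k * (π / M)) with ha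
  set b : ℕ → ℝ := fun k => g (k * (π / M)) with hb
  have hanonneg : ∀ k, 0 ≤ a k := fun k =>
    hfs.edge_nonneg (by positivity) (pi_div_le_pi_div_two hM) _
  have main : (∑ k ∈ Finset.range (2 * M), b k * a k) * s ≤
      (1 - cos (π / M)) / 2 * (∑ k ∈ Finset.range (2 * M), a k) *
        ∑ k ∈ Finset.range (2 * M), b k := by
    calc (∑ k ∈ Finset.range (2 * M), b k * a k) * s
        = ∑ j ∈ Finset.range (2 * M), a j * (b j * s) := by
          rw [Finset.sum_mul]; exact Finset.sum_congr rfl fun k _ => by ring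
      _ ≤ ∑ j ∈ Finset.range (2 * M), a j * ∑ k ∈ Finset.range (2 * M), b k *
            ((1 - cos (π / M)) / 2 + π / M * s / π * cos (k * (π / M) - j * (π / M))) :=
          Finset.sum_le_sum fun j _ =>
            mul_le_mul_of_nonneg_left (mul_sin_le_sum hg hgs hM j) (hanonneg j)
      _ = ∑ k ∈ Finset.range (2 * M), b k * ((1 - cos (π / M)) / 2 *
            (∑ j ∈ Finset.range (2 * M), a j) + π / M * s / π *
              ∑ j ∈ Finset.range (2 * M), a j * cos (k * (π / M) - j * (π / M))) := by
          simp only [Finset.mul_sum, ← Finset.sum_add_distrib]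
          rw [Finset.sum_comm]
          exact Finset.sum_congr rfl fun k _ => Finset.sum_congr rfl fun j _ => by ring
      _ = _ := by
          simp only [ha, sum_edge_mul_cos hf hM0, mul_zero, add_zero]
          rw [← Finset.sum_mul, mul_comm]
  have e1 : polygonForm M g f = (∑ k ∈ Finset.range (2 * M), b k * a k) / s / 2 := by
    simp only [polygonForm, Finset.sum_div, hs, ha, hb]
  have e2 : polygonForm M (fun _ => 1) f = (∑ k ∈ Finset.range (2 * M), a k) / s / 2 := by
    simp only [polygonForm, Finset.sum_div, one_mul, hs, ha]
  have e3 : polygonForm M g (fun _ => 1) =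
      (1 - cos (π / M)) * (∑ k ∈ Finset.range (2 * M), b k) / s := by
    simp only [polygonForm, edge, Finset.mul_sum, Finset.sum_div, hs, hb]
    exact Finset.sum_congr rfl fun k _ => by ring
  rw [e1, e2, e3]
  calc _ = (∑ k ∈ Finset.range (2 * M), b k * a k) * s / s ^ 2 := by field_simp
    _ ≤ _ := div_le_div_of_nonneg_right main (by positivity)
    _ = _ := by field_simp

end DiscreteMixedArea

section MixedVolume

variable {K T : Set Plane}

lemma tendsto_polygonForm_self (hK : Convex ℝ K) (hKc : IsCompact K) (h0 : (0 : Plane) ∈ K) :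
    Tendsto (fun M : ℕ => polygonForm M (supp K) (supp K)) atTop (𝓝 (area K)) := by
  refine (tendsto_area_polygon_supp hK hKc ⟨0, h0⟩).congr' ?_
  filter_upwards [eventually_ge_atTop 2] with M hM
  exact area_polygon (supp_periodic K) (angleSublinear_supp hKc ⟨0, h0⟩) (supp_nonneg hKc h0) hM

lemma tendsto_polygonForm (hK : Convex ℝ K) (hKc : IsCompact K) (hK0 : (0 : Plane) ∈ K)
    (hT : Convex ℝ T) (hTc : IsCompact T) (hT0 : (0 : Plane) ∈ T) :
    Tendsto (fun M : ℕ => polygonForm M (supp K) (supp T)) atTop (𝓝 (mixedVol K T)) := by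
  have hsum : supp (K + T) = supp K + supp T :=
    funext (supp_add hKc ⟨0, hK0⟩ hTc ⟨0, hT0⟩)
  have h0 : (0 : Plane) ∈ K + T := ⟨0, hK0, 0, hT0, add_zero 0⟩
  refine ((((tendsto_polygonForm_self (hK.add hT) (hKc.add hTc) h0).sub
    (tendsto_polygonForm_self hK hKc hK0)).sub
    (tendsto_polygonForm_self hT hTc hT0)).div_const 2).congr' ?_
  filter_upwards [eventually_gt_atTop 0] with M hM
  rw [hsum, polygonForm_add_left, polygonForm_add_right, polygonForm_add_right,
    polygonForm_comm (supp_periodic T) (supp_periodic K) hM]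
  ring

lemma mixedVol_comm (K T : Set Plane) : mixedVol K T = mixedVol T K := by
  rw [mixedVol, mixedVol, add_comm K T]; ring

lemma area_vadd (a : Plane) (K : Set Plane) : area (a +ᵥ K) = area K := by
  rw [area, measure_vadd, area]

lemma mixedVol_vadd_left (a : Plane) (K T : Set Plane) :
    mixedVol (a +ᵥ K) T = mixedVol K T := by
  rw [mixedVol, vadd_add_assoc, area_vadd, area_vadd, mixedVol]

lemma mixedVol_vadd_right (a : Plane) (K T : Set Plane) :
    mixedVol K (a +ᵥ T) = mixedVol K T := by
  rw [mixedVol_comm, mixedVol_vadd_left, mixedVol_comm]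

lemma two_mul_mixedVol_le_of_zero_mem (hK : Convex ℝ K) (hKc : IsCompact K)
    (hK0 : (0 : Plane) ∈ K) (hT : Convex ℝ T) (hTc : IsCompact T) (hT0 : (0 : Plane) ∈ T) :
    2 * mixedVol T K ≤
      mixedVol T (Metric.closedBall 0 1) * mixedVol K (Metric.closedBall 0 1) := by
  have hB : Convex ℝ (Metric.closedBall (0 : Plane) 1) := convex_closedBall 0 1
  have hBc : IsCompact (Metric.closedBall (0 : Plane) 1) := isCompact_closedBall 0 1
  have hB0 : (0 : Plane) ∈ Metric.closedBall (0 : Plane) 1 := by simp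
  have hsB : supp (Metric.closedBall 0 1) = fun _ => 1 := funext supp_closedBall
  rw [mul_comm (mixedVol T _), mixedVol_comm K (Metric.closedBall 0 1)]
  have lhs := (tendsto_polygonForm hT hTc hT0 hK hKc hK0).const_mul 2
  have rhs := (tendsto_polygonForm hB hBc hB0 hK hKc hK0).mul
    (tendsto_polygonForm hT hTc hT0 hB hBc hB0)
  refine le_of_tendsto_of_tendsto lhs rhs ?_
  filter_upwards [eventually_ge_atTop 2] with M hM
  rw [hsB]
  exact polygonForm_le (supp_periodic K) (angleSublinear_supp hKc ⟨0, hK0⟩) (supp_periodic T)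
    (angleSublinear_supp hTc ⟨0, hT0⟩) hM

/-- The inequality of Betke and Weil for the mixed area of two planar convex bodies. -/
theorem two_mul_mixedVol_le (hK : Convex ℝ K) (hKc : IsCompact K) (hKne : K.Nonempty)
    (hT : Convex ℝ T) (hTc : IsCompact T) (hTne : T.Nonempty) :
    2 * mixedVol T K ≤
      mixedVol T (Metric.closedBall 0 1) * mixedVol K (Metric.closedBall 0 1) := by
  obtain ⟨a, ha⟩ := hKne
  obtain ⟨b, hb⟩ := hTne
  have := two_mul_mixedVol_le_of_zero_mem (hK.vadd (-a)) (hKc.vadd (-a))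
    ⟨a, ha, by simp⟩ (hT.vadd (-b)) (hTc.vadd (-b)) ⟨b, hb, by simp⟩
  simpa only [mixedVol_vadd_left, mixedVol_vadd_right] using this

lemma area_closedBall {r : ℝ} (hr : 0 ≤ r) : area (Metric.closedBall 0 r) = π * r ^ 2 := by
  rw [area, EuclideanSpace.volume_closedBall_fin_two, ENNReal.toReal_mul, ENNReal.toReal_pow,
    ENNReal.toReal_ofReal hr]
  simp [mul_comm, pi_pos.le]

lemma mixedVol_closedBall :
    mixedVol (Metric.closedBall 0 1) (Metric.closedBall 0 1) = π := by
  rw [mixedVol, closedBall_add_closedBall zero_le_one zero_le_one, add_zero,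
    area_closedBall zero_le_one, area_closedBall (by norm_num)]
  ring

end MixedVolume

/-- `V(T,B)·V(K,B) ≥ (2/π)·V(T,K)·V(B,B)` where `B` is the closed unit disk. -/
theorem planar_mixedVol_ball_ineq
    {K T : Set (EuclideanSpace ℝ (Fin 2))}
    (hK : Convex ℝ K) (hKc : IsCompact K) (hKne : K.Nonempty)
    (hT : Convex ℝ T) (hTc : IsCompact T) (hTne : T.Nonempty) :
    mixedVol T (Metric.closedBall (0 : EuclideanSpace ℝ (Fin 2)) 1) *
        mixedVol K (Metric.closedBall (0 : EuclideanSpace ℝ (Fin 2)) 1) ≥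
      (2 / Real.pi) * mixedVol T K *
        mixedVol (Metric.closedBall (0 : EuclideanSpace ℝ (Fin 2)) 1)
          (Metric.closedBall (0 : EuclideanSpace ℝ (Fin 2)) 1) := by
  have h := two_mul_mixedVol_le hK hKc hKne hT hTc hTne
  rw [mixedVol_closedBall]
  calc 2 / π * mixedVol T K * π = 2 * mixedVol T K := by field_simp
    _ ≤ _ := h
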